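/- Let n ≥ 1 and let ℓ : Fin (n+1) → ℝ satisfy ℓ 0 = 1/2 (the BOS offset) and ℓ j ∈ {0,1} for j ≠ 0, and let S = {j ≠ 0 : ℓ j = 1} be the set of selected positions. Then as β → ∞: if S is nonempty, softmax(β·ℓ)_j converges to 1/|S| for j ∈ S and to 0 for all other positions (including BOS); if S is empty, softmax(β·ℓ)_0 converges to 1 and all other weights converge to 0. Thus with BOS offset 1/2, the BOS token is attended to if and only if no other token is selected. -/

import Mathlib

open Filter Topology

theorem softmax_aux {n : ℕ} (l : Fin (n + 1) → ℝ) (m : ℝ) (T : Finset (Fin (n + 1)))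
    (hT : T.Nonempty) (h1 : ∀ i ∈ T, l i = m) (h2 : ∀ i, i ∉ T → l i < m) (j : Fin (n + 1)) :
    Tendsto (fun β : ℝ => Real.exp (β * l j) / ∑ i, Real.exp (β * l i)) atTop
        (𝓝 (if j ∈ T then 1 / (T.card : ℝ) else 0)) := by
  have key : ∀ i, Tendsto (fun β : ℝ => Real.exp (β * (l i - m))) atTop
      (𝓝 (if i ∈ T then (1 : ℝ) else 0)) := by
    intro i
    by_cases hi : i ∈ T
    · simp [hi, h1 i hi]
    · simp only [hi, if_false]
      exact Real.tendsto_exp_atBot.comp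
        (tendsto_id.atTop_mul_const_of_neg (by linarith [h2 i hi]))
  have hsum := tendsto_finsetSum Finset.univ (fun i _ => key i)
  have hc : (∑ i, if i ∈ T then (1 : ℝ) else 0) = T.card := by simp
  rw [hc] at hsum
  have hne : (T.card : ℝ) ≠ 0 := by exact_mod_cast hT.card_pos.ne'
  have h := (key j).div hsum hne
  have e : (if j ∈ T then (1 : ℝ) else 0) / (T.card : ℝ)
      = if j ∈ T then 1 / (T.card : ℝ) else 0 := by split_ifs <;> simp
  rw [e] at h
  refine h.congr fun β => ?_
  have e2 : ∀ i, Real.exp (β * (l i - m)) = Real.exp (β * l i) * Real.exp (-(β * m)) := by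
    intro i
    rw [← Real.exp_add]
    ring_nf
  simp only [Pi.div_apply, e2]
  rw [← Finset.sum_mul, mul_div_mul_right _ _ (Real.exp_pos _).ne']

theorem stmt_14 (n : ℕ) (hn : 1 ≤ n) (ℓ : Fin (n + 1) → ℝ)
    (hℓ0 : ℓ 0 = 1 / 2)
    (hℓ : ∀ j : Fin (n + 1), j ≠ 0 → ℓ j = 0 ∨ ℓ j = 1)
    (S : Finset (Fin (n + 1)))
    (hS : S = Finset.univ.filter fun j => j ≠ 0 ∧ ℓ j = 1) :
    (S.Nonempty → ∀ j : Fin (n + 1),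
      Tendsto (fun β : ℝ => Real.exp (β * ℓ j) / ∑ i, Real.exp (β * ℓ i)) atTop
        (𝓝 (if j ∈ S then 1 / (S.card : ℝ) else 0))) ∧
    (S = ∅ → ∀ j : Fin (n + 1),
      Tendsto (fun β : ℝ => Real.exp (β * ℓ j) / ∑ i, Real.exp (β * ℓ i)) atTop
        (𝓝 (if j = 0 then 1 else 0))) := by
  constructor
  · intro hne j
    refine softmax_aux ℓ 1 S hne ?_ ?_ j
    · intro i hi
      rw [hS] at hi
      exact (Finset.mem_filter.1 hi).2.2
    · intro i hi
      rw [hS] at hi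
      simp only [Finset.mem_filter, Finset.mem_univ, true_and, not_and] at hi
      by_cases h0 : i = 0
      · rw [h0, hℓ0]; norm_num
      · rcases hℓ i h0 with h | h
        · rw [h]; norm_num
        · exact absurd h (hi h0)
  · intro hE j
    have := softmax_aux ℓ (1 / 2) {0} (by simp) (by simpa using hℓ0) ?_ j
    · simpa using this
    · intro i hi
      have h0 : i ≠ 0 := by simpa using hi
      rcases hℓ i h0 with h | h
      · rw [h]; norm_num
      · have : i ∈ S := by rw [hS]; simp [h0, h]
        simp [hE] at this
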